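/- arXiv:cs/0703144 — 3 statements merged into one kernel-verified Lean document; each statement's English description precedes it below -/
import Mathlib

section
/- Fix 0 < σ < 1 and u ≥ 0. Then ∫_0^∞ Φ(u, v, σ)·e^{−v} dv = e^{−u}, where Φ(u, v, σ) = (1/(1−σ²))·exp(−(u + σ²·v)/(1−σ²))·I₀(2σ·√(u·v)/(1−σ²)) for u ≥ 0, and I₀(x) = Σ_{k=0}^∞ (x/2)^{2k}/(k!)² is the modified Bessel function of order zero. -/
open MeasureTheory Real

/-- Modified Bessel function of order zero, `I₀(x) = ∑_{k=0}^∞ (x/2)^{2k}/(k!)²`. -/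
noncomputable def besselI0 (x : ℝ) : ℝ :=
  ∑' k : ℕ, (x / 2) ^ (2 * k) / ((Nat.factorial k : ℝ)) ^ 2

/-- Transition density `Φ(u, v, σ)` of the squared magnitude of a time-correlated
Rayleigh fading process with correlation coefficient `σ`, conditioned on the previous
squared magnitude being `v`: `Φ(u,v,σ) = (1/(1−σ²))·exp(−(u+σ²v)/(1−σ²))·I₀(2σ√(uv)/(1−σ²))`
for `u ≥ 0`, and `0` otherwise. -/
noncomputable def Phi (u v σ : ℝ) : ℝ :=
  if 0 ≤ u then
    (1 / (1 - σ ^ 2)) * Real.exp (-(u + σ ^ 2 * v) / (1 - σ ^ 2)) *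
      besselI0 (2 * σ * Real.sqrt (u * v) / (1 - σ ^ 2))
  else 0

theorem aux_int (k : ℕ) {a : ℝ} (ha : 0 < a) :
    IntegrableOn (fun v : ℝ => v ^ k * Real.exp (-(a * v))) (Set.Ioi 0) := by
  have h := integrableOn_rpow_mul_exp_neg_mul_rpow (p := 1) (s := (k : ℝ)) (b := a)
    (by have : (0 : ℝ) ≤ k := Nat.cast_nonneg k
        linarith) one_pos ha
  simpa [Real.rpow_natCast] using h

theorem aux_val (k : ℕ) {a : ℝ} (ha : 0 < a) :
    ∫ v in Set.Ioi (0 : ℝ), v ^ k * Real.exp (-(a * v)) =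
      (1 / a) ^ (k + 1) * (Nat.factorial k : ℝ) := by
  have h := integral_rpow_mul_exp_neg_mul_Ioi (a := (k : ℝ) + 1) (r := a) (by positivity) ha
  rw [Real.Gamma_nat_eq_factorial] at h
  rw [show ((k : ℝ) + 1) = ((k + 1 : ℕ) : ℝ) by push_cast; ring, Real.rpow_natCast] at h
  rw [← h]
  congr 1
  ext v
  rw [show (((k + 1 : ℕ) : ℝ) - 1) = (k : ℝ) by push_cast; ring, Real.rpow_natCast]

/-- The exponential density `e^{−v}` on `[0,∞)` is stationary for the transition
kernel `Φ`: `∫_0^∞ Φ(u, v, σ)·e^{−v} dv = e^{−u}`. -/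
theorem integral_Phi_mul_exp (σ u : ℝ) (hσ0 : 0 < σ) (hσ1 : σ < 1) (hu : 0 ≤ u) :
    ∫ v in Set.Ioi (0 : ℝ), Phi u v σ * Real.exp (-v) = Real.exp (-u) := by
  have hd : 0 < 1 - σ ^ 2 := by nlinarith
  obtain ⟨a, ha⟩ : ∃ a, a = 1 / (1 - σ ^ 2) := ⟨_, rfl⟩
  have ha0 : 0 < a := by rw [ha]; positivity
  have had : a * (1 - σ ^ 2) = 1 := by rw [ha]; field_simp
  set F : ℕ → ℝ → ℝ := fun k v =>
    (a * Real.exp (-(u * a)) * (σ ^ 2 * u * a ^ 2) ^ k / (Nat.factorial k : ℝ) ^ 2) *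
      (v ^ k * Real.exp (-(a * v))) with hF
  have hFint : ∀ k, Integrable (F k) (volume.restrict (Set.Ioi 0)) := fun k =>
    (aux_int k ha0).const_mul _
  have hFval : ∀ k, ∫ v in Set.Ioi (0 : ℝ), F k v =
      Real.exp (-(u * a)) * ((σ ^ 2 * u * a) ^ k / (Nat.factorial k : ℝ)) := by
    intro k
    simp only [hF]
    rw [integral_const_mul, aux_val k ha0]
    have hk : (Nat.factorial k : ℝ) ≠ 0 := by positivity
    have : (σ ^ 2 * u * a ^ 2) ^ k = (σ ^ 2 * u * a) ^ k * a ^ k := by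
      rw [← mul_pow]; ring
    rw [this, one_div, inv_pow, pow_succ]
    field_simp
    ring
  have hexp := (NormedSpace.expSeries_div_hasSum_exp (σ ^ 2 * u * a)).mul_left (Real.exp (-(u * a)))
  rw [← Real.exp_eq_exp_ℝ, ← Real.exp_add] at hexp
  have hsum : Summable fun k => ∫ v in Set.Ioi (0 : ℝ), ‖F k v‖ := by
    refine hexp.summable.congr fun k => ?_
    rw [← hFval k]
    refine setIntegral_congr_fun measurableSet_Ioi fun v hv => ?_
    have hv : 0 < v := hv
    have : 0 ≤ F k v := by simp only [hF]; positivity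
    exact (Real.norm_of_nonneg this).symm
  have key := hasSum_integral_of_summable_integral_norm hFint hsum
  simp only [hFval] at key
  have h2 := key.unique hexp
  rw [show -(u * a) + σ ^ 2 * u * a = -u by linear_combination (-u) * had] at h2
  rw [← h2]
  refine setIntegral_congr_fun measurableSet_Ioi fun v hv => ?_
  have hv : 0 < v := hv
  simp only [Phi, hu, if_true, besselI0]
  rw [mul_right_comm, ← tsum_mul_left]
  refine tsum_congr fun k => ?_
  simp only [hF]
  rw [← ha, mul_assoc a, ← Real.exp_add]
  have e1 : -(u + σ ^ 2 * v) / (1 - σ ^ 2) + -v = -(u * a) + -(a * v) := by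
    rw [div_eq_mul_one_div, ← ha]
    linear_combination v * had
  have e2 : (2 * σ * Real.sqrt (u * v) / (1 - σ ^ 2) / 2) ^ (2 * k)
      = (σ ^ 2 * u * a ^ 2) ^ k * v ^ k := by
    rw [pow_mul, ← mul_pow]
    congr 1
    rw [div_eq_mul_one_div (2 * σ * Real.sqrt (u * v)), ← ha]
    have := Real.sq_sqrt (mul_nonneg hu hv.le)
    linear_combination σ ^ 2 * a ^ 2 * this
  rw [e1, e2, Real.exp_add]
  ring
end

section
/- Fix 0 < σ < 1, 0 < τ < 1, u ≥ 0, and v ≥ 0. Then ∫_0^∞ Φ(u, w, σ)·Φ(w, v, τ) dw = Φ(u, v, σ·τ), where Φ(u, v, σ) = (1/(1−σ²))·exp(−(u + σ²·v)/(1−σ²))·I₀(2σ·√(u·v)/(1−σ²)) for u ≥ 0, and I₀(x) = Σ_{k=0}^∞ (x/2)^{2k}/(k!)² is the modified Bessel function of order zero. -/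
open MeasureTheory Real

noncomputable def bB (z : ℝ) : ℝ := ∑' k : ℕ, z ^ k / ((Nat.factorial k : ℝ)) ^ 2

lemma bB_summable {z : ℝ} (hz : 0 ≤ z) :
    Summable (fun k : ℕ => z ^ k / ((Nat.factorial k : ℝ)) ^ 2) := by
  refine Summable.of_nonneg_of_le (fun k => by positivity) (fun k => ?_)
    (Real.summable_pow_div_factorial z)
  have h1 : (1 : ℝ) ≤ (Nat.factorial k : ℝ) := by exact_mod_cast Nat.factorial_pos k
  apply div_le_div_of_nonneg_left (by positivity) (by positivity)
  nlinarith

lemma bB_nonneg {z : ℝ} (hz : 0 ≤ z) : 0 ≤ bB z := tsum_nonneg fun k => by positivity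

lemma ofReal_bB {z : ℝ} (hz : 0 ≤ z) :
    ENNReal.ofReal (bB z) = ∑' k : ℕ, ENNReal.ofReal (z ^ k / ((Nat.factorial k : ℝ)) ^ 2) :=
  ENNReal.ofReal_tsum_of_nonneg (fun k => by positivity) (bB_summable hz)

lemma vander (j k : ℕ) : ((j + k).choose k : ENNReal) =
    ∑' m : ℕ, (j.choose m : ENNReal) * (k.choose m : ENNReal) := by
  rw [tsum_eq_sum (s := Finset.range (k + 1))]
  · rw [Nat.add_choose_eq, Finset.Nat.sum_antidiagonal_eq_sum_range_succ_mk]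
    push_cast
    refine Finset.sum_congr rfl fun m hm => ?_
    rw [Nat.choose_symm (by simpa [Nat.lt_succ_iff] using hm)]
  · intro m hm
    have : k < m := by simpa using hm
    simp [Nat.choose_eq_zero_of_lt this]

lemma sum_choose {X : ℝ} (hX : 0 ≤ X) (m : ℕ) :
    ∑' j : ℕ, ENNReal.ofReal (X ^ j / (Nat.factorial j : ℝ)) * (j.choose m : ENNReal) =
      ENNReal.ofReal (X ^ m / (Nat.factorial m : ℝ) * Real.exp X) := by
  have hinj : Function.Injective (fun p : ℕ => m + p) := fun a b h => by simpa using h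
  rw [← hinj.tsum_eq]
  · rw [Real.exp_eq_exp_ℝ, NormedSpace.exp_eq_tsum_div, ← tsum_mul_left,
      ENNReal.ofReal_tsum_of_nonneg (fun n => by positivity)
        ((Real.summable_pow_div_factorial X).mul_left _)]
    refine tsum_congr fun p => ?_
    rw [← ENNReal.ofReal_natCast, ← ENNReal.ofReal_mul (by positivity)]
    congr 1
    rw [Nat.cast_add_choose]
    field_simp
    ring
  · intro j hj
    by_contra h
    apply hj
    have : j < m := by
      by_contra h2
      exact h ⟨j - m, by simp; omega⟩
    simp [Nat.choose_eq_zero_of_lt this]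

lemma double_sum {X Y : ℝ} (hX : 0 ≤ X) (hY : 0 ≤ Y) :
    ∑' j : ℕ, ∑' k : ℕ, ENNReal.ofReal (X ^ j / (Nat.factorial j : ℝ)) *
      ENNReal.ofReal (Y ^ k / (Nat.factorial k : ℝ)) * ((j + k).choose k : ENNReal) =
    ENNReal.ofReal (Real.exp (X + Y) * bB (X * Y)) := by
  simp_rw [vander, ← ENNReal.tsum_mul_left]
  have h1 : ∀ j : ℕ, (∑' k : ℕ, ∑' m : ℕ, ENNReal.ofReal (X ^ j / (Nat.factorial j : ℝ)) *
      ENNReal.ofReal (Y ^ k / (Nat.factorial k : ℝ)) * ((j.choose m : ENNReal) * (k.choose m : ENNReal)))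
      = ∑' m : ℕ, (ENNReal.ofReal (X ^ j / (Nat.factorial j : ℝ)) * (j.choose m : ENNReal)) *
        ENNReal.ofReal (Y ^ m / (Nat.factorial m : ℝ) * Real.exp Y) := by
    intro j
    rw [ENNReal.tsum_comm]
    refine tsum_congr fun m => ?_
    rw [← sum_choose hY, ← ENNReal.tsum_mul_left]
    refine tsum_congr fun k => ?_
    ring
  simp_rw [h1]
  rw [ENNReal.tsum_comm]
  simp_rw [ENNReal.tsum_mul_right, sum_choose hX]
  rw [ENNReal.ofReal_mul (Real.exp_pos _).le, ofReal_bB (by positivity), ← ENNReal.tsum_mul_left]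
  refine tsum_congr fun m => ?_
  rw [← ENNReal.ofReal_mul (by positivity), ← ENNReal.ofReal_mul (by positivity)]
  congr 1
  rw [Real.exp_add, mul_pow]
  field_simp

lemma lint_pow {c : ℝ} (hc : 0 < c) (n : ℕ) :
    ∫⁻ w in Set.Ioi (0 : ℝ), ENNReal.ofReal (w ^ n * Real.exp (-(c * w))) =
      ENNReal.ofReal ((Nat.factorial n : ℝ) / c ^ (n + 1)) := by
  have h := Real.integral_rpow_mul_exp_neg_mul_Ioi (a := (n : ℝ) + 1) (r := c) (by positivity) hc
  have e : ∫ w in Set.Ioi (0 : ℝ), w ^ n * Real.exp (-(c * w)) =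
      (Nat.factorial n : ℝ) / c ^ (n + 1) := by
    rw [add_sub_cancel_right, Real.Gamma_nat_eq_factorial] at h
    simp_rw [Real.rpow_natCast] at h
    rw [h]
    have : ((n : ℝ) + 1) = ((n + 1 : ℕ) : ℝ) := by push_cast; ring
    rw [this, Real.rpow_natCast]
    simp [div_eq_mul_inv, mul_comm]
  rw [← e, ofReal_integral_eq_lintegral_ofReal]
  · by_contra hni
    have := integral_undef hni
    rw [e] at this
    have : 0 < (Nat.factorial n : ℝ) / c ^ (n + 1) := by positivity
    linarith
  · filter_upwards [self_mem_ae_restrict measurableSet_Ioi] with w hw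
    have : (0 : ℝ) < w := hw
    simp only [Pi.zero_apply]
    positivity

lemma core_aux {A D c w : ℝ} (hA : 0 ≤ A) (hD : 0 ≤ D) (hw : 0 ≤ w) :
    ENNReal.ofReal (Real.exp (-(c * w)) * bB (A * w) * bB (D * w)) =
    ∑' j : ℕ, ∑' k : ℕ, ENNReal.ofReal (A ^ j / ((Nat.factorial j : ℝ)) ^ 2 *
      (D ^ k / ((Nat.factorial k : ℝ)) ^ 2)) *
        ENNReal.ofReal (w ^ (j + k) * Real.exp (-(c * w))) := by
  have hB := bB_nonneg (mul_nonneg hA hw)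
  rw [ENNReal.ofReal_mul (by positivity), ENNReal.ofReal_mul (by positivity),
    ofReal_bB (by positivity), ofReal_bB (by positivity), mul_assoc, ← ENNReal.tsum_mul_right,
    ← ENNReal.tsum_mul_left]
  refine tsum_congr fun j => ?_
  rw [← ENNReal.tsum_mul_left, ← ENNReal.tsum_mul_left]
  refine tsum_congr fun k => ?_
  rw [← ENNReal.ofReal_mul (by positivity), ← ENNReal.ofReal_mul (by positivity),
    ← ENNReal.ofReal_mul (by positivity)]
  congr 1
  ring

lemma core {A D c : ℝ} (hA : 0 ≤ A) (hD : 0 ≤ D) (hc : 0 < c) :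
    ∫ w in Set.Ioi (0 : ℝ), Real.exp (-(c * w)) * bB (A * w) * bB (D * w) =
    1 / c * (Real.exp ((A + D) / c) * bB (A * D / c ^ 2)) := by
  have hm : ∀ j k : ℕ, Measurable fun w : ℝ => ENNReal.ofReal (A ^ j / ((Nat.factorial j : ℝ)) ^ 2 *
      (D ^ k / ((Nat.factorial k : ℝ)) ^ 2)) *
        ENNReal.ofReal (w ^ (j + k) * Real.exp (-(c * w))) := by
    intro j k; fun_prop
  have hB : ∀ w, 0 < w → 0 ≤ Real.exp (-(c * w)) * bB (A * w) * bB (D * w) := by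
    intro w hw
    have := bB_nonneg (mul_nonneg hA hw.le)
    have := bB_nonneg (mul_nonneg hD hw.le)
    positivity
  have h1 : ∫ w in Set.Ioi (0 : ℝ), Real.exp (-(c * w)) * bB (A * w) * bB (D * w) =
      ∫ w in Set.Ioi (0 : ℝ), (∑' j : ℕ, ∑' k : ℕ,
        ENNReal.ofReal (A ^ j / ((Nat.factorial j : ℝ)) ^ 2 *
      (D ^ k / ((Nat.factorial k : ℝ)) ^ 2)) *
        ENNReal.ofReal (w ^ (j + k) * Real.exp (-(c * w)))).toReal := by
    refine setIntegral_congr_fun measurableSet_Ioi fun w hw => ?_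
    have hw' : (0 : ℝ) < w := hw
    rw [← core_aux hA hD hw'.le, ENNReal.toReal_ofReal (hB w hw')]
  rw [h1, integral_toReal]
  rotate_left
  · exact (Measurable.tsum fun j => Measurable.tsum fun k => hm j k).aemeasurable
  · filter_upwards [self_mem_ae_restrict measurableSet_Ioi] with w hw
    have hw' : (0 : ℝ) < w := hw
    rw [← core_aux hA hD hw'.le]
    exact ENNReal.ofReal_lt_top
  rw [lintegral_tsum fun j => (Measurable.tsum fun k => hm j k).aemeasurable]
  simp_rw [lintegral_tsum fun k => (hm _ k).aemeasurable]
  have h2 : ∀ j k : ℕ, ∫⁻ w in Set.Ioi (0 : ℝ), ENNReal.ofReal (A ^ j / ((Nat.factorial j : ℝ)) ^ 2 *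
      (D ^ k / ((Nat.factorial k : ℝ)) ^ 2)) *
        ENNReal.ofReal (w ^ (j + k) * Real.exp (-(c * w))) =
      ENNReal.ofReal (1 / c) * (ENNReal.ofReal ((A / c) ^ j / (Nat.factorial j : ℝ)) *
      ENNReal.ofReal ((D / c) ^ k / (Nat.factorial k : ℝ)) * ((j + k).choose k : ENNReal)) := by
    intro j k
    rw [lintegral_const_mul _ (by fun_prop), lint_pow hc, ← ENNReal.ofReal_natCast,
      ← ENNReal.ofReal_mul (by positivity), ← ENNReal.ofReal_mul (by positivity),
      ← ENNReal.ofReal_mul (by positivity), ← ENNReal.ofReal_mul (by positivity)]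
    congr 1
    rw [Nat.add_comm j k, Nat.cast_add_choose, div_pow, div_pow]
    field_simp
    ring
  simp_rw [h2, ENNReal.tsum_mul_left]
  have h3 := double_sum (X := A / c) (Y := D / c) (by positivity) (by positivity)
  simp_rw [mul_assoc, ENNReal.tsum_mul_left] at h3 ⊢
  rw [h3, ← ENNReal.ofReal_mul (by positivity), ENNReal.toReal_ofReal]
  · congr 3
    · ring
    · field_simp
  · have := bB_nonneg (z := A / c * (D / c)) (by positivity)
    positivity

lemma Phi_eq {u v σ : ℝ} (hu : 0 ≤ u) (hv : 0 ≤ v) :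
    Phi u v σ = (1 / (1 - σ ^ 2)) * Real.exp (-(u + σ ^ 2 * v) / (1 - σ ^ 2)) *
      bB (σ ^ 2 * (u * v) / (1 - σ ^ 2) ^ 2) := by
  rw [Phi, if_pos hu]
  congr 1
  unfold besselI0 bB
  refine tsum_congr fun k => ?_
  rw [pow_mul]
  congr 2
  rw [div_pow, div_pow, mul_pow, mul_pow, Real.sq_sqrt (by positivity)]
  ring

/-- Chapman–Kolmogorov semigroup identity for the Rayleigh-fading transition kernel:
`∫_0^∞ Φ(u, w, σ)·Φ(w, v, τ) dw = Φ(u, v, σ·τ)`. -/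
theorem integral_Phi_comp (σ τ u v : ℝ) (hσ0 : 0 < σ) (hσ1 : σ < 1)
    (hτ0 : 0 < τ) (hτ1 : τ < 1) (hu : 0 ≤ u) (hv : 0 ≤ v) :
    ∫ w in Set.Ioi (0 : ℝ), Phi u w σ * Phi w v τ = Phi u v (σ * τ) := by
  have hs : 0 < 1 - σ ^ 2 := by nlinarith
  have ht : 0 < 1 - τ ^ 2 := by nlinarith
  have hst : 0 < 1 - σ ^ 2 * τ ^ 2 := by nlinarith [sq_nonneg σ, sq_nonneg τ]
  rw [Phi_eq hu hv]
  have h := core (A := σ ^ 2 * u / (1 - σ ^ 2) ^ 2) (D := τ ^ 2 * v / (1 - τ ^ 2) ^ 2)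
    (c := (1 - σ ^ 2 * τ ^ 2) / ((1 - σ ^ 2) * (1 - τ ^ 2))) (by positivity) (by positivity)
    (by positivity)
  have h1 : ∫ w in Set.Ioi (0 : ℝ), Phi u w σ * Phi w v τ =
      ∫ w in Set.Ioi (0 : ℝ), (1 / ((1 - σ ^ 2) * (1 - τ ^ 2)) *
        Real.exp (-u / (1 - σ ^ 2) - τ ^ 2 * v / (1 - τ ^ 2))) *
        (Real.exp (-((1 - σ ^ 2 * τ ^ 2) / ((1 - σ ^ 2) * (1 - τ ^ 2)) * w)) *
          bB (σ ^ 2 * u / (1 - σ ^ 2) ^ 2 * w) * bB (τ ^ 2 * v / (1 - τ ^ 2) ^ 2 * w)) := by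
    refine setIntegral_congr_fun measurableSet_Ioi fun w hw => ?_
    have hw' : (0 : ℝ) < w := hw
    rw [Phi_eq hu hw'.le, Phi_eq hw'.le hv]
    have e1 : σ ^ 2 * (u * w) / (1 - σ ^ 2) ^ 2 = σ ^ 2 * u / (1 - σ ^ 2) ^ 2 * w := by ring
    have e2 : τ ^ 2 * (w * v) / (1 - τ ^ 2) ^ 2 = τ ^ 2 * v / (1 - τ ^ 2) ^ 2 * w := by ring
    have e3 : Real.exp (-(u + σ ^ 2 * w) / (1 - σ ^ 2)) * Real.exp (-(w + τ ^ 2 * v) / (1 - τ ^ 2))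
        = Real.exp (-u / (1 - σ ^ 2) - τ ^ 2 * v / (1 - τ ^ 2)) *
        Real.exp (-((1 - σ ^ 2 * τ ^ 2) / ((1 - σ ^ 2) * (1 - τ ^ 2)) * w)) := by
      rw [← Real.exp_add, ← Real.exp_add]
      congr 1
      field_simp
      ring
    rw [e1, e2]
    generalize bB _ = p, bB _ = q
    rw [← one_div_mul_one_div]
    linear_combination (p * q * (1 / (1 - σ ^ 2)) * (1 / (1 - τ ^ 2))) * e3
  rw [h1, integral_const_mul, h]
  have e4 : σ ^ 2 * u / (1 - σ ^ 2) ^ 2 * (τ ^ 2 * v / (1 - τ ^ 2) ^ 2) /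
      ((1 - σ ^ 2 * τ ^ 2) / ((1 - σ ^ 2) * (1 - τ ^ 2))) ^ 2 =
      (σ * τ) ^ 2 * (u * v) / (1 - (σ * τ) ^ 2) ^ 2 := by
    rw [mul_pow]
    field_simp
  have e5 : Real.exp (-(u + (σ * τ) ^ 2 * v) / (1 - (σ * τ) ^ 2)) =
      Real.exp (-u / (1 - σ ^ 2) - τ ^ 2 * v / (1 - τ ^ 2)) *
      Real.exp ((σ ^ 2 * u / (1 - σ ^ 2) ^ 2 + τ ^ 2 * v / (1 - τ ^ 2) ^ 2) /
        ((1 - σ ^ 2 * τ ^ 2) / ((1 - σ ^ 2) * (1 - τ ^ 2)))) := by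
    rw [← Real.exp_add, mul_pow]
    congr 1
    field_simp
    ring
  rw [e4, e5, mul_pow]
  field_simp
end

section
/- Let (Ω, P) be a finite probability space and let U, V, W be random variables on Ω taking finitely many values, with U ≥ 0. Assume U and W are conditionally independent given V, i.e., for every v with P(V = v) > 0 and all values u, w: P(U = u, W = w | V = v) = P(U = u | V = v)·P(W = w | V = v). Let f be a nonnegative function of (W, V), and define g(v) = E[f(W, V) | V = v] for each v with P(V = v) > 0. Then E[log(1 + U·f(W, V))] ≤ E[log(1 + U·g(V))]. -/
open Finset
open scoped Classical

theorem aux_group {Ω : Type*} [Fintype Ω] (X : Ω → ℝ) (F : Ω → ℝ) :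
    ∑ ω, F ω = ∑ x ∈ univ.image X, ∑ ω, if X ω = x then F ω else 0 := by
  rw [Finset.sum_comm]
  refine Finset.sum_congr rfl fun ω _ => ?_
  rw [Finset.sum_ite_eq]
  simp

theorem aux_one {Ω : Type*} [Fintype Ω] (q : Ω → ℝ) (X : Ω → ℝ) (a : ℝ → ℝ) :
    ∑ ω, q ω * a (X ω) = ∑ x ∈ univ.image X, a x * ∑ ω, if X ω = x then q ω else 0 := by
  rw [aux_group X]
  refine Finset.sum_congr rfl fun x _ => ?_
  rw [Finset.mul_sum]
  refine Finset.sum_congr rfl fun ω _ => ?_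
  split_ifs with h
  · rw [h, mul_comm]
  · simp

theorem aux_prod {Ω : Type*} [Fintype Ω] (q : Ω → ℝ) (U W : Ω → ℝ) (P : ℝ)
    (h : ∀ u w, (∑ ω, if U ω = u ∧ W ω = w then q ω else 0) * P =
      (∑ ω, if U ω = u then q ω else 0) * (∑ ω, if W ω = w then q ω else 0))
    (a b : ℝ → ℝ) :
    (∑ ω, q ω * a (U ω) * b (W ω)) * P =
      (∑ ω, q ω * a (U ω)) * (∑ ω, q ω * b (W ω)) := by
  have h1 : ∑ ω, q ω * a (U ω) * b (W ω) = ∑ u ∈ univ.image U, ∑ w ∈ univ.image W,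
      a u * b w * ∑ ω, if U ω = u ∧ W ω = w then q ω else 0 := by
    rw [aux_one (fun ω => q ω * a (U ω)) W b, Finset.sum_comm]
    refine Finset.sum_congr rfl fun w _ => ?_
    have : (∑ ω, if W ω = w then q ω * a (U ω) else 0)
        = ∑ ω, (if W ω = w then q ω else 0) * a (U ω) := by
      refine Finset.sum_congr rfl fun ω _ => ?_
      split_ifs <;> simp
    rw [this, aux_one _ U a, Finset.mul_sum]
    refine Finset.sum_congr rfl fun u _ => ?_
    simp only [ite_and]
    ring
  rw [h1, aux_one q U a, aux_one q W b, Finset.sum_mul_sum, Finset.sum_mul]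
  refine Finset.sum_congr rfl fun u _ => ?_
  rw [Finset.sum_mul]
  refine Finset.sum_congr rfl fun w _ => ?_
  rw [mul_assoc, h]
  ring

/-- On a finite probability space, if `U ≥ 0` and `U` and `W` are conditionally
independent given `V`, then for any nonnegative function `f` of `(W, V)`, replacing
`f(W, V)` by its conditional expectation `g(V) = E[f(W, V) | V]` does not decrease
`E[log(1 + U·f(W, V))]`. -/
theorem expectation_log_le_of_condIndep {Ω : Type*} [Fintype Ω]
    (p : Ω → ℝ) (hp : ∀ ω, 0 ≤ p ω) (hsum : ∑ ω, p ω = 1)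
    (U V W : Ω → ℝ) (hU : ∀ ω, 0 ≤ U ω)
    (hindep : ∀ v u w, 0 < (∑ ω, if V ω = v then p ω else 0) →
      (∑ ω, if U ω = u ∧ W ω = w ∧ V ω = v then p ω else 0) /
          (∑ ω, if V ω = v then p ω else 0) =
        ((∑ ω, if U ω = u ∧ V ω = v then p ω else 0) /
            (∑ ω, if V ω = v then p ω else 0)) *
          ((∑ ω, if W ω = w ∧ V ω = v then p ω else 0) /
            (∑ ω, if V ω = v then p ω else 0)))
    (f : ℝ → ℝ → ℝ) (hf : ∀ w v, 0 ≤ f w v)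
    (g : ℝ → ℝ)
    (hg : ∀ v, 0 < (∑ ω, if V ω = v then p ω else 0) →
      g v = (∑ ω, if V ω = v then p ω * f (W ω) (V ω) else 0) /
        (∑ ω, if V ω = v then p ω else 0)) :
    ∑ ω, p ω * Real.log (1 + U ω * f (W ω) (V ω)) ≤
      ∑ ω, p ω * Real.log (1 + U ω * g (V ω)) := by
  have hPnn : ∀ v, 0 ≤ (∑ ω, if V ω = v then p ω else 0) := fun v =>
    Finset.sum_nonneg fun ω _ => by split_ifs; exacts [hp ω, le_rfl]
  have hle : ∀ ω, p ω ≤ ∑ ω', if V ω' = V ω then p ω' else 0 := by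
    intro ω
    have := Finset.single_le_sum (s := univ) (f := fun ω' => if V ω' = V ω then p ω' else 0)
      (fun ω' _ => by split_ifs; exacts [hp ω', le_rfl]) (Finset.mem_univ ω)
    simpa using this
  have key : ∑ ω, p ω * (U ω / (1 + U ω * g (V ω)) * (f (W ω) (V ω) - g (V ω))) = 0 := by
    rw [aux_group V]
    refine Finset.sum_eq_zero fun v _ => ?_
    rcases (hPnn v).eq_or_lt with h0 | hpos
    · refine Finset.sum_eq_zero fun ω _ => ?_
      split_ifs with h
      · have h1 := hle ω
        rw [h, ← h0] at h1
        rw [le_antisymm h1 (hp ω), zero_mul]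
      · rfl
    · have hgv := hg v hpos
      have hi := fun u w => hindep v u w hpos
      set P := ∑ ω, if V ω = v then p ω else 0 with hP
      have hne : P ≠ 0 := hpos.ne'
      have hpr := aux_prod (fun ω => if V ω = v then p ω else 0) U W P (by
        intro u w
        have h2 := hi u w
        field_simp at h2
        simp only [ite_and] at h2
        simp only [ite_and]
        linarith) (fun u => u / (1 + u * g v)) (fun w => f w v)
      have hB : ∑ ω, (if V ω = v then p ω else 0) * f (W ω) v = g v * P := by
        rw [hgv, div_mul_cancel₀ _ hne]
        refine Finset.sum_congr rfl fun ω _ => ?_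
        split_ifs with h
        · rw [h]
        · simp
      rw [hB, ← mul_assoc] at hpr
      have h3 := mul_right_cancel₀ hne hpr
      rw [Finset.sum_mul, ← sub_eq_zero, ← Finset.sum_sub_distrib] at h3
      refine Eq.trans ?_ h3
      refine Finset.sum_congr rfl fun ω _ => ?_
      split_ifs with h
      · rw [h]; ring
      · simp
  rw [← add_zero (∑ ω, p ω * Real.log (1 + U ω * g (V ω))), ← key, ← Finset.sum_add_distrib]
  refine Finset.sum_le_sum fun ω _ => ?_
  rw [← mul_add]
  rcases (hp ω).eq_or_lt with h0 | hpos
  · simp [← h0]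
  refine mul_le_mul_of_nonneg_left ?_ (hp ω)
  have hPv := lt_of_lt_of_le hpos (hle ω)
  have hgn : 0 ≤ g (V ω) := by
    rw [hg _ hPv]
    refine div_nonneg (Finset.sum_nonneg fun ω' _ => ?_) hPv.le
    split_ifs
    exacts [mul_nonneg (hp _) (hf _ _), le_rfl]
  have ha : 0 < 1 + U ω * g (V ω) := by have := mul_nonneg (hU ω) hgn; linarith
  have hb : 0 < 1 + U ω * f (W ω) (V ω) := by
    have := mul_nonneg (hU ω) (hf (W ω) (V ω)); linarith
  have hl := Real.log_le_sub_one_of_pos (div_pos hb ha)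
  rw [Real.log_div hb.ne' ha.ne'] at hl
  have : (1 + U ω * f (W ω) (V ω)) / (1 + U ω * g (V ω)) - 1 =
      U ω / (1 + U ω * g (V ω)) * (f (W ω) (V ω) - g (V ω)) := by
    field_simp
    ring
  linarith
end
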